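/- Let G be a finitely generated group, n a natural number, ρ : G → GL(n, ℂ) a group homomorphism, and g ∈ G an element with ρ(g) ≠ 1. Then there exists a finite group H and a group homomorphism φ : G → H such that φ(g) ≠ 1. In particular, every finitely generated subgroup of GL(n, ℂ) is residually finite. -/

import Mathlib

theorem int_isJacobsonRing : IsJacobsonRing ℤ := by
  rw [isJacobsonRing_iff_prime_eq]
  intro P hP
  by_cases h : P = ⊥
  · subst h
    rw [eq_bot_iff]
    intro x hx
    rw [Ideal.mem_jacobson_bot] at hx
    have h1 := Int.isUnit_iff.mp (hx x)
    have h2 : x * x = 0 := by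
      rcases h1 with h1 | h1
      · linarith
      · nlinarith [mul_self_nonneg x]
    simpa using h2
  · have := hP.isMaximal h
    exact Ideal.jacobson_eq_self_of_isMaximal

theorem finite_field_of_finiteType_int (K : Type) [Field K] [Algebra.FiniteType ℤ K] :
    Finite K := by
  have := int_isJacobsonRing
  have hfin : Module.Finite ℤ K := finite_of_finite_type_of_isJacobsonRing ℤ K
  have hnot : ¬ Function.Injective (algebraMap ℤ K) := by
    intro hinj
    have hint : Algebra.IsIntegral ℤ K := inferInstance
    exact Int.not_isField (isField_of_isIntegral_of_isField hinj (Field.toIsField K))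
  rw [injective_iff_map_eq_zero] at hnot
  push Not at hnot
  obtain ⟨m, hm, hm0⟩ := hnot
  apply Module.finite_of_fg_torsion K
  intro x
  refine ⟨⟨m, mem_nonZeroDivisors_of_ne_zero hm0⟩, ?_⟩
  change m • x = 0
  rw [Algebra.smul_def, hm, zero_mul]

theorem exists_maximal_notMem (A : Type) [CommRing A] [IsDomain A] [Algebra.FiniteType ℤ A]
    (a : A) (ha : a ≠ 0) : ∃ m : Ideal A, m.IsMaximal ∧ a ∉ m ∧ Finite (A ⧸ m) := by
  have := int_isJacobsonRing
  have hJ : IsJacobsonRing A := isJacobsonRing_of_finiteType (A := ℤ)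
  have h1 : (⊥ : Ideal A).jacobson = ⊥ :=
    isJacobsonRing_iff_prime_eq.mp hJ ⊥ Ideal.isPrime_bot
  have h2 : a ∉ (⊥ : Ideal A).jacobson := by rw [h1]; simpa using ha
  rw [Ideal.jacobson, Submodule.mem_sInf] at h2
  push Not at h2
  obtain ⟨m, ⟨-, hm⟩, ham⟩ := h2
  refine ⟨m, hm, ham, ?_⟩
  let := Ideal.Quotient.field m
  have : Algebra.FiniteType ℤ (A ⧸ m) :=
    Algebra.FiniteType.of_surjective (Ideal.Quotient.mk m).toIntAlgHom
      Ideal.Quotient.mk_surjective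
  exact @finite_field_of_finiteType_int (A ⧸ m) _ this

/-- Malcev's theorem for complex linear groups: if `G` is a finitely generated
group, `ρ : G → GL(n, ℂ)` a homomorphism and `g ∈ G` with `ρ g ≠ 1`, then there
is a finite group `H` and a homomorphism `φ : G → H` with `φ g ≠ 1`. -/
theorem stmt3 (G : Type) [Group G] [Group.FG G] (n : ℕ)
    (ρ : G →* Matrix.GeneralLinearGroup (Fin n) ℂ) (g : G) (hg : ρ g ≠ 1) :
    ∃ (H : Type) (_ : Group H), Finite H ∧ ∃ φ : G →* H, φ g ≠ 1 := by
  have hfg : Monoid.FG G := Group.fg_iff_monoid_fg.mp inferInstance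
  obtain ⟨S, hS, hSf⟩ := Monoid.fg_iff.mp hfg
  let T : Set ℂ := ⋃ s ∈ S, Set.range fun p : Fin n × Fin n => (ρ s : Matrix (Fin n) (Fin n) ℂ) p.1 p.2
  have hT : T.Finite := hSf.biUnion fun s _ => Set.finite_range _
  let A : Subalgebra ℤ ℂ := Algebra.adjoin ℤ T
  have hA : Algebra.FiniteType ℤ A := .adjoin_of_finite hT
  have hmem : ∀ x : G, ∀ i j, (ρ x : Matrix (Fin n) (Fin n) ℂ) i j ∈ A := by
    intro x
    have hx : x ∈ Submonoid.closure S := by rw [hS]; trivial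
    induction hx using Submonoid.closure_induction with
    | mem s hs =>
      intro i j
      apply Algebra.subset_adjoin
      exact Set.mem_biUnion hs ⟨(i, j), rfl⟩
    | one =>
      intro i j
      rw [map_one, Units.val_one, Matrix.one_apply]
      split_ifs
      · exact A.one_mem
      · exact A.zero_mem
    | mul x y _ _ hx hy =>
      intro i j
      rw [map_mul, Units.val_mul, Matrix.mul_apply]
      exact A.sum_mem fun k _ => A.mul_mem (hx i k) (hy k j)
  let σ : G →* Matrix (Fin n) (Fin n) A :=
    { toFun := fun x => Matrix.of fun i j => ⟨(ρ x : Matrix (Fin n) (Fin n) ℂ) i j, hmem x i j⟩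
      map_one' := by
        ext i j
        by_cases h : i = j <;> simp [Matrix.one_apply, h]
      map_mul' := by
        intro x y
        ext i j
        simp [Matrix.mul_apply] }
  have hne : σ g ≠ 1 := by
    intro h
    apply hg
    ext i j
    have h3 := congrArg (fun M : Matrix (Fin n) (Fin n) A => ((M i j : A) : ℂ)) h
    by_cases hij : i = j <;> simpa [σ, Matrix.one_apply, hij] using h3
  obtain ⟨i, j, hij⟩ : ∃ i j, σ g i j - (1 : Matrix (Fin n) (Fin n) A) i j ≠ 0 := by
    by_contra! h
    exact hne (by ext i j; rw [sub_eq_zero.mp (h i j)])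
  obtain ⟨m, -, ham, hfin⟩ := exists_maximal_notMem A _ hij
  let τ : G →* Matrix (Fin n) (Fin n) (A ⧸ m) :=
    ((Ideal.Quotient.mk m).mapMatrix.toMonoidHom).comp σ
  have : Finite (Matrix (Fin n) (Fin n) (A ⧸ m)) := inferInstanceAs (Finite (Fin n → Fin n → A ⧸ m))
  refine ⟨(Matrix (Fin n) (Fin n) (A ⧸ m))ˣ, inferInstance, inferInstance, τ.toHomUnits, ?_⟩
  intro h
  apply ham
  have h4 : τ g = 1 := by
    rw [← MonoidHom.coe_toHomUnits, h, Units.val_one]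
  have h5 : (Ideal.Quotient.mk m) (σ g i j) = (1 : Matrix (Fin n) (Fin n) (A ⧸ m)) i j :=
    congrFun (congrFun h4 i) j
  rw [← Ideal.Quotient.eq_zero_iff_mem, map_sub, h5]
  by_cases hc : i = j <;> simp [Matrix.one_apply, hc]
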